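/- Let ζ ∈ ℝ with 0 < ζ < 1, and define u : ℝ × ℝ → ℝ by u(x,t) = 4 · arctan( sinh( ζ t / √(1 − ζ²) ) / ( ζ · cosh( x / √(1 − ζ²) ) ) ). Then u satisfies the Sine-Gordon equation ∂ₜₜu(x,t) − ∂ₓₓu(x,t) + sin(u(x,t)) = 0 for all (x,t) ∈ ℝ × ℝ. -/

import Mathlib

/-- Quadruple-angle formula for `sin` at `arctan w`. -/
lemma sin_four_mul_arctan (w : ℝ) :
    Real.sin (4 * Real.arctan w) = 4 * w * (1 - w ^ 2) / (1 + w ^ 2) ^ 2 := by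
  have hpos : (1 + w ^ 2) ≠ 0 := by positivity
  have hc : Real.cos (Real.arctan w) ^ 2 = 1 / (1 + w ^ 2) := Real.cos_sq_arctan w
  have hs : Real.sin (Real.arctan w) = w * Real.cos (Real.arctan w) := by
    rw [Real.sin_arctan, Real.cos_arctan]; ring
  have h4 : 4 * Real.arctan w = 2 * (2 * Real.arctan w) := by ring
  have hexp : Real.sin (4 * Real.arctan w) =
      4 * w * Real.cos (Real.arctan w) ^ 2 * (2 * Real.cos (Real.arctan w) ^ 2 - 1) := by
    rw [h4, Real.sin_two_mul, Real.sin_two_mul, Real.cos_two_mul, hs]; ring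
  rw [hexp, hc]
  field_simp
  ring

lemma hasDerivAt_kink_antikink_time {ζ g A : ℝ} (hζ : ζ ≠ 0) (hg : g ≠ 0) (hA : A ≠ 0) (t : ℝ) :
    HasDerivAt (fun r => 4 * Real.arctan (Real.sinh (ζ * r / g) / (ζ * A)))
      (4 * ζ ^ 2 * A / g *
        (Real.cosh (ζ * t / g) / (ζ ^ 2 * A ^ 2 + Real.sinh (ζ * t / g) ^ 2))) t := by
  have hlin : HasDerivAt (fun r : ℝ => ζ * r / g) (ζ * 1 / g) t :=
    ((hasDerivAt_id t).const_mul ζ).div_const g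
  have hD : ζ ^ 2 * A ^ 2 + Real.sinh (ζ * t / g) ^ 2 ≠ 0 := by positivity
  have hw : 1 + (Real.sinh (ζ * t / g) / (ζ * A)) ^ 2 ≠ 0 := by positivity
  refine ((hlin.sinh.div_const (ζ * A)).arctan.const_mul 4).congr_deriv ?_
  field_simp

lemma hasDerivAt_kink_antikink_time_time {ζ g A : ℝ} (hζ : ζ ≠ 0) (hA : A ≠ 0) (t : ℝ) :
    HasDerivAt (fun s => 4 * ζ ^ 2 * A / g *
        (Real.cosh (ζ * s / g) / (ζ ^ 2 * A ^ 2 + Real.sinh (ζ * s / g) ^ 2)))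
      (4 * ζ ^ 3 * A * Real.sinh (ζ * t / g) / g ^ 2 *
        (ζ ^ 2 * A ^ 2 + Real.sinh (ζ * t / g) ^ 2 - 2 * Real.cosh (ζ * t / g) ^ 2) /
        (ζ ^ 2 * A ^ 2 + Real.sinh (ζ * t / g) ^ 2) ^ 2) t := by
  have hlin : HasDerivAt (fun r : ℝ => ζ * r / g) (ζ * 1 / g) t :=
    ((hasDerivAt_id t).const_mul ζ).div_const g
  have hD : ζ ^ 2 * A ^ 2 + Real.sinh (ζ * t / g) ^ 2 ≠ 0 := by positivity
  refine ((hlin.cosh.div ((hlin.sinh.pow 2).const_add (ζ ^ 2 * A ^ 2)) hD).const_mul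
    (4 * ζ ^ 2 * A / g)).congr_deriv ?_
  simp only [Pi.pow_apply]
  ring

lemma hasDerivAt_kink_antikink_space {ζ g : ℝ} (hζ : ζ ≠ 0) (hg : g ≠ 0) (S x : ℝ) :
    HasDerivAt (fun z => 4 * Real.arctan (S / (ζ * Real.cosh (z / g))))
      (-(4 * ζ * S) / g *
        (Real.sinh (x / g) / (ζ ^ 2 * Real.cosh (x / g) ^ 2 + S ^ 2))) x := by
  have hlin : HasDerivAt (fun z : ℝ => z / g) (1 / g) x := (hasDerivAt_id x).div_const g
  have hA : 0 < Real.cosh (x / g) := Real.cosh_pos _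
  have hD : ζ ^ 2 * Real.cosh (x / g) ^ 2 + S ^ 2 ≠ 0 := by positivity
  have hw : 1 + (S / (ζ * Real.cosh (x / g))) ^ 2 ≠ 0 := by positivity
  refine (((hasDerivAt_const x S).div (hlin.cosh.const_mul ζ)
    (mul_ne_zero hζ hA.ne')).arctan.const_mul 4).congr_deriv ?_
  simp only [Pi.div_apply]
  field_simp
  ring

lemma hasDerivAt_kink_antikink_space_space {ζ g : ℝ} (hζ : ζ ≠ 0) (S x : ℝ) :
    HasDerivAt (fun y => -(4 * ζ * S) / g *
        (Real.sinh (y / g) / (ζ ^ 2 * Real.cosh (y / g) ^ 2 + S ^ 2)))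
      (-(4 * ζ * S * Real.cosh (x / g)) / g ^ 2 *
        (ζ ^ 2 * Real.cosh (x / g) ^ 2 + S ^ 2 - 2 * ζ ^ 2 * Real.sinh (x / g) ^ 2) /
        (ζ ^ 2 * Real.cosh (x / g) ^ 2 + S ^ 2) ^ 2) x := by
  have hlin : HasDerivAt (fun z : ℝ => z / g) (1 / g) x := (hasDerivAt_id x).div_const g
  have hA : 0 < Real.cosh (x / g) := Real.cosh_pos _
  have hD : ζ ^ 2 * Real.cosh (x / g) ^ 2 + S ^ 2 ≠ 0 := by positivity
  refine ((hlin.sinh.div (((hlin.cosh.pow 2).const_mul (ζ ^ 2)).add_const (S ^ 2)) hD).const_mul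
    (-(4 * ζ * S) / g)).congr_deriv ?_
  simp only [Pi.pow_apply]
  ring

/-- The kink–antikink solution (5.2) satisfies the one-dimensional
Sine-Gordon equation `∂ₜₜu − ∂ₓₓu + sin u = 0`. -/
theorem kink_antikink_solves_sine_gordon
    (ζ : ℝ) (hζ0 : 0 < ζ) (hζ1 : ζ < 1)
    (u : ℝ → ℝ → ℝ)
    (hu : ∀ x t : ℝ, u x t = 4 * Real.arctan
      (Real.sinh (ζ * t / Real.sqrt (1 - ζ ^ 2))
        / (ζ * Real.cosh (x / Real.sqrt (1 - ζ ^ 2))))) :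
    ∀ x t : ℝ,
      deriv (fun s => deriv (fun r => u x r) s) t
        - deriv (fun y => deriv (fun z => u z t) y) x
        + Real.sin (u x t) = 0 := by
  intro x t
  have hpos : 0 < 1 - ζ ^ 2 := by nlinarith
  have hg0 : 0 < Real.sqrt (1 - ζ ^ 2) := Real.sqrt_pos.2 hpos
  have hg2 : Real.sqrt (1 - ζ ^ 2) ^ 2 = 1 - ζ ^ 2 := Real.sq_sqrt hpos.le
  simp only [hu]
  generalize Real.sqrt (1 - ζ ^ 2) = g at *
  have hA0 : 0 < Real.cosh (x / g) := Real.cosh_pos _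
  simp only [fun s => (hasDerivAt_kink_antikink_time hζ0.ne' hg0.ne' hA0.ne' s).deriv,
    fun y => (hasDerivAt_kink_antikink_space hζ0.ne' hg0.ne' (Real.sinh (ζ * t / g)) y).deriv,
    (hasDerivAt_kink_antikink_time_time hζ0.ne' hA0.ne' t).deriv,
    (hasDerivAt_kink_antikink_space_space hζ0.ne' (Real.sinh (ζ * t / g)) x).deriv,
    sin_four_mul_arctan, hg2, Real.cosh_sq (ζ * t / g), Real.sinh_sq (x / g)]
  generalize Real.sinh (ζ * t / g) = S
  generalize Real.cosh (x / g) = A at *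
  have hD : ζ ^ 2 * A ^ 2 + S ^ 2 ≠ 0 := by positivity
  have hsin : 4 * (S / (ζ * A)) * (1 - (S / (ζ * A)) ^ 2) / (1 + (S / (ζ * A)) ^ 2) ^ 2 =
      4 * ζ * A * S * (ζ ^ 2 * A ^ 2 - S ^ 2) / (ζ ^ 2 * A ^ 2 + S ^ 2) ^ 2 := by
    have hw : 1 + (S / (ζ * A)) ^ 2 ≠ 0 := by positivity
    field_simp
  rw [hsin]
  have hne := hpos.ne'
  field_simp
  ring
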